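/- arXiv:1312.5476 — 3 statements merged into one kernel-verified Lean document; each statement's English description precedes it below -/
import Mathlib

section
/- Let E be a real inner product space and let F : Fin 4 → Fin 4 → E be antisymmetric (F_{μν} = −F_{νμ}). Define the energy-momentum components T_{μν} := Σ_{β,β'} η^{ββ'} ⟨F_{μβ}, F_{νβ'}⟩ − (1/4)·η_{μν}·Σ_{α,α',β,β'} η^{αα'} η^{ββ'} ⟨F_{αβ}, F_{α'β'}⟩. Then T_{00} = (1/2)·(‖F_{01}‖² + ‖F_{02}‖² + ‖F_{03}‖² + ‖F_{12}‖² + ‖F_{13}‖² + ‖F_{23}‖²); in particular T_{00} ≥ 0. -/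
open RealInnerProductSpace

/-- The Minkowski metric `η = diag(−1,1,1,1)` on the index set `{0,1,2,3}`
(its inverse has the same components). -/
def η (μ ν : Fin 4) : ℝ := if μ = ν then (if μ = 0 then -1 else 1) else 0

/-- **Positivity of the Yang–Mills energy density.**
Let `E` be a real inner product space and `F : Fin 4 → Fin 4 → E` antisymmetric.
Define `T_{μν} := Σ_{β,β'} η^{ββ'} ⟨F_{μβ}, F_{νβ'}⟩
  − (1/4)·η_{μν}·Σ_{α,α',β,β'} η^{αα'} η^{ββ'} ⟨F_{αβ}, F_{α'β'}⟩`.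
Then `T₀₀ = (1/2)(‖F₀₁‖² + ‖F₀₂‖² + ‖F₀₃‖² + ‖F₁₂‖² + ‖F₁₃‖² + ‖F₂₃‖²)`;
in particular `T₀₀ ≥ 0`. -/
theorem stmt2 {E : Type*} [NormedAddCommGroup E] [InnerProductSpace ℝ E]
    (F : Fin 4 → Fin 4 → E) (hF : ∀ μ ν, F μ ν = - F ν μ)
    (T : Fin 4 → Fin 4 → ℝ)
    (hT : ∀ μ ν, T μ ν = (∑ β, ∑ β', η β β' * ⟪F μ β, F ν β'⟫)
        - (1/4 : ℝ) * η μ ν *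
          ∑ α, ∑ α', ∑ β, ∑ β', η α α' * η β β' * ⟪F α β, F α' β'⟫) :
    T 0 0 = (1/2 : ℝ) * (‖F 0 1‖^2 + ‖F 0 2‖^2 + ‖F 0 3‖^2
        + ‖F 1 2‖^2 + ‖F 1 3‖^2 + ‖F 2 3‖^2) ∧ 0 ≤ T 0 0 := by
  have hd : ∀ μ, F μ μ = 0 := fun μ => by
    have h2 : (2 : ℝ) • F μ μ = 0 := by
      rw [two_smul]
      exact eq_neg_iff_add_eq_zero.mp (hF μ μ)
    exact (smul_eq_zero.mp h2).resolve_left two_ne_zero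
  have key : T 0 0 = (1/2 : ℝ) * (‖F 0 1‖^2 + ‖F 0 2‖^2 + ‖F 0 3‖^2
        + ‖F 1 2‖^2 + ‖F 1 3‖^2 + ‖F 2 3‖^2) := by
    have e : ∀ (c : Fin 4) (f : Fin 4 → ℝ),
        ∑ b, η c b * f b = (if c = 0 then -1 else 1) * f c := by
      intro c f
      simp [η]
    have e2 : ∀ α α', (∑ β, ∑ β', η α α' * η β β' * ⟪F α β, F α' β'⟫)
        = η α α' * ∑ β, (if β = 0 then -1 else 1) * ⟪F α β, F α' β⟫ := by
      intro α α'
      simp only [mul_assoc, ← Finset.mul_sum, e]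
    rw [hT]
    simp only [e2, e]
    simp only [Fin.sum_univ_four, hd, real_inner_self_eq_norm_sq,
      hF 1 0, hF 2 0, hF 3 0, hF 2 1, hF 3 1, hF 3 2, norm_neg, norm_zero]
    simp [η]
    ring
  exact ⟨key, by rw [key]; positivity⟩
end

section
/- Let {L, L̄, e₁, e₂} be a null frame on (V,g), let E be a real inner product space, let F : V × V → E be an antisymmetric bilinear map, let ν ≠ 0 be a real number, and set t̂ := −(1/2)·(ν⁻¹·L + ν·L̄). Writing (f_L, f_{L̄}, f_1, f_2) := (L, L̄, e₁, e₂) and letting G be the null-frame inverse metric components G^{LL̄} = G^{L̄L} = −1/2, G^{11} = G^{22} = 1, all other components 0, define T(X,Y) := Σ_{β,β'} G^{ββ'} ⟨F(X,f_β), F(Y,f_{β'})⟩ − (1/4)·g(X,Y)·Σ_{α,α',β,β'} G^{αα'} G^{ββ'} ⟨F(f_α,f_β), F(f_{α'},f_{β'})⟩. Then T(L,t̂) = −(1/8)·ν·‖F(L,L̄)‖² − (1/2)·ν⁻¹·(‖F(L,e₁)‖² + ‖F(L,e₂)‖²) − (1/2)·ν·‖F(e₁,e₂)‖². In particular, if ν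 > 0 then −T(L,t̂) ≥ 0. -/
open RealInnerProductSpace

/-- The inverse metric components in a null frame `{L, L̄, e₁, e₂}` (indices
`0 = L`, `1 = L̄`, `2 = e₁`, `3 = e₂`): `G^{LL̄} = G^{L̄L} = −1/2`,
`G^{11} = G^{22} = 1`, all other components `0`. -/
noncomputable def Gnull (μ ν : Fin 4) : ℝ :=
  if (μ = 0 ∧ ν = 1) ∨ (μ = 1 ∧ ν = 0) then -(1/2)
  else if μ = ν ∧ (μ = 2 ∨ μ = 3) then 1 else 0

theorem Gnull_sum (h : Fin 4 → Fin 4 → ℝ) :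
    ∑ β, ∑ β', Gnull β β' * h β β' =
      -(1/2) * h 0 1 - (1/2) * h 1 0 + h 2 2 + h 3 3 := by
  simp [Fin.sum_univ_four, Gnull]
  ring

/-- **The null flux density of the Yang–Mills energy-momentum tensor.**
Let `{L, L̄, e₁, e₂}` be a null frame on `(V,g)`, `F : V × V → E` an
antisymmetric bilinear map into a real inner product space, `ν ≠ 0`, and
`t̂ := −(1/2)(ν⁻¹ L + ν L̄)`.  With `(f_0,f_1,f_2,f_3) = (L,L̄,e₁,e₂)` and the
null-frame inverse metric `G`, define
`T(X,Y) := Σ_{β,β'} G^{ββ'} ⟨F(X,f_β), F(Y,f_β')⟩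
  − (1/4)·g(X,Y)·Σ G^{αα'} G^{ββ'} ⟨F(f_α,f_β), F(f_α',f_β')⟩`.
Then `T(L,t̂) = −(1/8)ν‖F(L,L̄)‖² − (1/2)ν⁻¹(‖F(L,e₁)‖² + ‖F(L,e₂)‖²)
  − (1/2)ν‖F(e₁,e₂)‖²`; in particular if `ν > 0` then `−T(L,t̂) ≥ 0`. -/
theorem stmt3 {V E : Type*} [AddCommGroup V] [Module ℝ V]
    [NormedAddCommGroup E] [InnerProductSpace ℝ E]
    (g : V →ₗ[ℝ] V →ₗ[ℝ] ℝ) (hg : ∀ x y : V, g x y = g y x)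
    (L Lb e₁ e₂ : V)
    (h1 : g L L = 0) (h2 : g Lb Lb = 0) (h3 : g L Lb = -2)
    (h4 : g e₁ e₁ = 1) (h5 : g e₂ e₂ = 1) (h6 : g e₁ e₂ = 0)
    (h7 : g L e₁ = 0) (h8 : g L e₂ = 0) (h9 : g Lb e₁ = 0) (h10 : g Lb e₂ = 0)
    (hspan : Submodule.span ℝ ({L, Lb, e₁, e₂} : Set V) = ⊤)
    (F : V →ₗ[ℝ] V →ₗ[ℝ] E) (hF : ∀ x y : V, F x y = - F y x)
    (ν : ℝ) (hν0 : ν ≠ 0)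
    (that : V) (hthat : that = (-(1/2 : ℝ)) • (ν⁻¹ • L + ν • Lb))
    (f : Fin 4 → V) (hf : f = ![L, Lb, e₁, e₂])
    (T : V → V → ℝ)
    (hT : ∀ X Y : V, T X Y =
      (∑ β, ∑ β', Gnull β β' * ⟪F X (f β), F Y (f β')⟫)
        - (1/4 : ℝ) * g X Y *
          ∑ α, ∑ α', ∑ β, ∑ β',
            Gnull α α' * Gnull β β' * ⟪F (f α) (f β), F (f α') (f β')⟫) :
    T L that = -(1/8 : ℝ) * ν * ‖F L Lb‖^2
        - (1/2 : ℝ) * ν⁻¹ * (‖F L e₁‖^2 + ‖F L e₂‖^2)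
        - (1/2 : ℝ) * ν * ‖F e₁ e₂‖^2
      ∧ (0 < ν → 0 ≤ - T L that) := by
  have hself : ∀ x : V, F x x = 0 := by
    intro x
    have h := hF x x
    have h2' : (2 : ℝ) • F x x = 0 := by
      rw [two_smul]
      exact eq_neg_iff_add_eq_zero.mp h
    exact (smul_eq_zero.mp h2').resolve_left two_ne_zero
  have key : T L that = -(1/8 : ℝ) * ν * ‖F L Lb‖^2
        - (1/2 : ℝ) * ν⁻¹ * (‖F L e₁‖^2 + ‖F L e₂‖^2)
        - (1/2 : ℝ) * ν * ‖F e₁ e₂‖^2 := by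
    have hgt : g L that = ν := by
      rw [hthat]
      simp only [map_add, map_smul, h1, h3, smul_eq_mul]
      ring
    have hFt : ∀ x, F that x = (-(1/2 : ℝ)) • (ν⁻¹ • F L x + ν • F Lb x) := by
      intro x
      rw [hthat]
      simp only [map_add, map_smul, LinearMap.add_apply, LinearMap.smul_apply]
    rw [hT, hgt, Gnull_sum (fun β β' => ⟪F L (f β), F that (f β')⟫)]
    simp only [mul_assoc, ← Finset.mul_sum]
    simp only [Gnull_sum (fun β β' => ⟪F (f _) (f β), F (f _) (f β')⟫)]
    rw [Gnull_sum (fun α α' => -(1/2) * ⟪F (f α) (f 0), F (f α') (f 1)⟫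
      - (1/2) * ⟪F (f α) (f 1), F (f α') (f 0)⟫
      + ⟪F (f α) (f 2), F (f α') (f 2)⟫ + ⟪F (f α) (f 3), F (f α') (f 3)⟫)]
    have f0 : f 0 = L := by rw [hf]; rfl
    have f1 : f 1 = Lb := by rw [hf]; rfl
    have f2 : f 2 = e₁ := by rw [hf]; rfl
    have f3 : f 3 = e₂ := by rw [hf]; rfl
    simp only [f0, f1, f2, f3, hFt, hself, hF Lb L, hF e₁ L, hF e₂ L, hF e₁ Lb, hF e₂ Lb,
      hF e₂ e₁, inner_neg_left, inner_neg_right, inner_add_right, inner_smul_right,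
      inner_zero_left, inner_zero_right, real_inner_self_eq_norm_sq,
      real_inner_comm (F L e₁) (F Lb e₁), real_inner_comm (F L e₂) (F Lb e₂)]
    ring
  refine ⟨key, fun hν => ?_⟩
  rw [key]
  have a : 0 ≤ ν * ‖F L Lb‖^2 := by positivity
  have b : 0 ≤ ν⁻¹ * (‖F L e₁‖^2 + ‖F L e₂‖^2) := by positivity
  have c : 0 ≤ ν * ‖F e₁ e₂‖^2 := by positivity
  linarith
end

section
/- Let a < b be real numbers, let f : [a,b] → ℝ be continuous and nonnegative, and let c > 0 and A, B ≥ 0 be constants such that for all t ∈ [a,b], f(t) ≤ c + A·∫_a^t f(s)² ds + B·∫_a^t (∫_a^σ f(s)² ds) dσ. Then for every t ∈ [a,b] satisfying c·(A·(t−a) + (1/2)·B·(t−a)²) < 1, one has f(t) ≤ c / (1 − c·(A·(t−a) + (1/2)·B·(t−a)²)). In particular f remains bounded on a sufficiently small interval [a, a+δ] with δ depending only on c, A, B. -/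
theorem stmt12_aux (a b : ℝ) (f : ℝ → ℝ)
    (hf : Continuous f) (hf0 : ∀ t, 0 ≤ f t)
    (c A B : ℝ) (hc : 0 < c) (hA : 0 ≤ A) (hB : 0 ≤ B)
    (hineq : ∀ t ∈ Set.Icc a b,
      f t ≤ c + A * (∫ s in a..t, (f s)^2)
        + B * ∫ σ in a..t, (∫ s in a..σ, (f s)^2)) :
    ∀ t ∈ Set.Icc a b,
      c * (A * (t - a) + (1/2 : ℝ) * B * (t - a)^2) < 1 →
        f t ≤ c / (1 - c * (A * (t - a) + (1/2 : ℝ) * B * (t - a)^2)) := by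
  intro t ht hlt
  have hf2 : Continuous (fun s => (f s)^2) := hf.pow 2
  obtain ⟨G, hG⟩ : ∃ G : ℝ → ℝ, G = fun σ => ∫ s in a..σ, (f s)^2 := ⟨_, rfl⟩
  have hGd : ∀ x, HasDerivAt G ((f x)^2) x := by
    intro x
    rw [hG]
    exact hf2.integral_hasStrictDerivAt a x |>.hasDerivAt
  have hGc : Continuous G := continuous_iff_continuousAt.2 fun x => (hGd x).continuousAt
  obtain ⟨U, hU⟩ : ∃ U : ℝ → ℝ, U = fun x => c + A * G x + B * ∫ σ in a..x, G σ := ⟨_, rfl⟩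
  have hUd : ∀ x, HasDerivAt U (A * (f x)^2 + B * G x) x := by
    intro x
    rw [hU]
    exact (((hGd x).const_mul A).const_add c).add
      ((hGc.integral_hasStrictDerivAt a x |>.hasDerivAt).const_mul B)
  have hUc : Continuous U := continuous_iff_continuousAt.2 fun x => (hUd x).continuousAt
  have hfU : ∀ x ∈ Set.Icc a b, f x ≤ U x := by
    intro x hx
    have := hineq x hx
    rw [hU, hG]
    exact this
  have hG0 : ∀ x, a ≤ x → 0 ≤ G x := by
    intro x hx
    rw [hG]
    exact intervalIntegral.integral_nonneg hx fun s _ => sq_nonneg _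
  have hUa : U a = c := by simp [hU, hG]
  have hmono : MonotoneOn U (Set.Ici a) := by
    apply monotoneOn_of_deriv_nonneg (convex_Ici a) hUc.continuousOn
      (fun x _ => (hUd x).differentiableAt.differentiableWithinAt)
    intro x hx
    rw [interior_Ici] at hx
    rw [(hUd x).deriv]
    have := hG0 x (le_of_lt hx)
    positivity
  have hUc' : ∀ x, a ≤ x → c ≤ U x := by
    intro x hx
    rw [← hUa]
    exact hmono Set.self_mem_Ici hx hx
  have hGle : ∀ x ∈ Set.Icc a b, G x ≤ (x - a) * (U x)^2 := by
    intro x hx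
    have h1 : (∫ s in a..x, (f s)^2) ≤ ∫ s in a..x, (U x)^2 := by
      apply intervalIntegral.integral_mono_on hx.1 (hf2.intervalIntegrable _ _)
        (continuous_const.intervalIntegrable _ _)
      intro s hs
      have h2 := hfU s ⟨hs.1, hs.2.trans hx.2⟩
      have h3 : U s ≤ U x := hmono hs.1 hx.1 hs.2
      exact pow_le_pow_left₀ (hf0 s) (h2.trans h3) 2
    rw [intervalIntegral.integral_const, smul_eq_mul] at h1
    rw [hG]
    exact h1
  obtain ⟨H, hH⟩ : ∃ H : ℝ → ℝ,
    H = fun x => (U x)⁻¹ + (A * (x - a) + (1/2 : ℝ) * B * (x - a)^2) := ⟨_, rfl⟩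
  have hHd : ∀ x, a ≤ x →
      HasDerivAt H (-(A * (f x)^2 + B * G x) / (U x)^2 + (A + B * (x - a))) x := by
    intro x hx
    have hne : U x ≠ 0 := (hc.trans_le (hUc' x hx)).ne'
    have e1 := (hUd x).fun_inv hne
    have e0 := (hasDerivAt_id x).sub_const a
    have e2 := (e0.const_mul A).add ((e0.pow 2).const_mul ((1/2 : ℝ) * B))
    rw [hH]
    refine (e1.add e2).congr_deriv ?_
    simp only [id, Nat.cast_ofNat]
    ring
  have hHm : MonotoneOn H (Set.Icc a b) := by
    apply monotoneOn_of_deriv_nonneg (convex_Icc a b)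
      (fun x hx => (hHd x hx.1).continuousAt.continuousWithinAt)
    · intro x hx
      have hx := interior_subset hx
      exact (hHd x hx.1).differentiableAt.differentiableWithinAt
    · intro x hx
      have hx := interior_subset hx
      rw [(hHd x hx.1).deriv]
      have hp : 0 < U x := hc.trans_le (hUc' x hx.1)
      have h1 : (f x)^2 ≤ (U x)^2 := pow_le_pow_left₀ (hf0 x) (hfU x hx) 2
      have h2 := mul_le_mul_of_nonneg_left h1 hA
      have h3 := mul_le_mul_of_nonneg_left (hGle x hx) hB
      have h4 : (A * (f x)^2 + B * G x) / (U x)^2 ≤ A + B * (x - a) := by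
        rw [div_le_iff₀ (by positivity)]
        linarith
      rw [neg_div]
      linarith
  have hfin := hHm ⟨le_rfl, ht.1.trans ht.2⟩ ht ht.1
  rw [hH] at hfin
  simp only [hUa, sub_self] at hfin
  have hp : 0 < U t := hc.trans_le (hUc' t ht.1)
  refine (hfU t ht).trans ?_
  generalize A * (t - a) + (1/2 : ℝ) * B * (t - a)^2 = p at *
  have h5 : c⁻¹ ≤ (U t)⁻¹ + p := by linarith
  rw [le_div_iff₀ (by linarith)]
  have h6 := mul_le_mul_of_nonneg_left h5 (mul_pos hc hp).le
  have e1 : c * U t * c⁻¹ = U t := by field_simp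
  have e2 : c * U t * ((U t)⁻¹ + p) = c + c * U t * p := by field_simp
  rw [e1, e2] at h6
  linarith

/-- **Pachpatte's Gronwall-type inequality.**
Let `a < b`, let `f : [a,b] → ℝ` be continuous and nonnegative, and let
`c > 0` and `A, B ≥ 0` satisfy
`f(t) ≤ c + A·∫_a^t f(s)² ds + B·∫_a^t (∫_a^σ f(s)² ds) dσ` on `[a,b]`.
Then for every `t ∈ [a,b]` with `c·(A(t−a) + (1/2)B(t−a)²) < 1` one has
`f(t) ≤ c / (1 − c·(A(t−a) + (1/2)B(t−a)²))`. -/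
theorem stmt12 (a b : ℝ) (hab : a < b) (f : ℝ → ℝ)
    (hf : ContinuousOn f (Set.Icc a b)) (hf0 : ∀ t ∈ Set.Icc a b, 0 ≤ f t)
    (c A B : ℝ) (hc : 0 < c) (hA : 0 ≤ A) (hB : 0 ≤ B)
    (hineq : ∀ t ∈ Set.Icc a b,
      f t ≤ c + A * (∫ s in a..t, (f s)^2)
        + B * ∫ σ in a..t, (∫ s in a..σ, (f s)^2)) :
    ∀ t ∈ Set.Icc a b,
      c * (A * (t - a) + (1/2 : ℝ) * B * (t - a)^2) < 1 →
        f t ≤ c / (1 - c * (A * (t - a) + (1/2 : ℝ) * B * (t - a)^2)) := by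
  obtain ⟨g, hg⟩ : ∃ g : ℝ → ℝ, g = Set.IccExtend hab.le ((Set.Icc a b).domRestrict f) := ⟨_, rfl⟩
  have hgc : Continuous g := by
    rw [hg]
    exact (continuousOn_iff_continuous_domRestrict.1 hf).Icc_extend'
  have hgf : ∀ x ∈ Set.Icc a b, g x = f x := by
    intro x hx
    rw [hg, Set.IccExtend_of_mem _ _ hx]
    rfl
  have hg0 : ∀ x, 0 ≤ g x := by
    intro x
    rw [hg]
    exact hf0 _ (Set.projIcc a b hab.le x).2
  have hI : ∀ x ∈ Set.Icc a b, (∫ s in a..x, (g s)^2) = ∫ s in a..x, (f s)^2 := by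
    intro x hx
    apply intervalIntegral.integral_congr
    intro s hs
    rw [Set.uIcc_of_le hx.1] at hs
    simp only [hgf s ⟨hs.1, hs.2.trans hx.2⟩]
  have hJ : ∀ x ∈ Set.Icc a b, (∫ σ in a..x, (∫ s in a..σ, (g s)^2))
      = ∫ σ in a..x, (∫ s in a..σ, (f s)^2) := by
    intro x hx
    apply intervalIntegral.integral_congr
    intro s hs
    rw [Set.uIcc_of_le hx.1] at hs
    exact hI s ⟨hs.1, hs.2.trans hx.2⟩
  intro t ht hlt
  rw [← hgf t ht]
  refine stmt12_aux a b g hgc hg0 c A B hc hA hB ?_ t ht hlt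
  intro x hx
  rw [hgf x hx, hI x hx, hJ x hx]
  exact hineq x hx
end
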